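/- arXiv:2103.10067 — 2 statements merged into one kernel-verified Lean document; each statement's English description precedes it below -/
import Mathlib

section
/- Let (ιₖ, pₖ)_{k∈ℤ} be an admissible sequence and let s, t ∈ ℤ be such that ιₛ ∼ ιₜ (the vertices ιₛ and ιₜ are adjacent in Δ). Then: (i) pₛ < pₜ if and only if s < t; (ii) pₛ − pₜ − a ∈ 2aℤ, where a := min(d_{ιₛ}, d_{ιₜ}). -/
open Set

variable {I : Type*} [Fintype I]

/-- The cardinality `dᵢ` of the `⟨σ⟩`-orbit of `i`. -/
noncomputable def orbSize (σ : Equiv.Perm I) (i : I) : ℕ :=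
  Nat.card {j : I | ∃ k : ℤ, (σ ^ k) i = j}

/-- `s⁺ = min {t | s < t, ι t = ι s}`. -/
noncomputable def splus (ιs : ℤ → I) (s : ℤ) : ℤ := sInf {t : ℤ | s < t ∧ ιs t = ιs s}

/-- `s⁻ = max {t | t < s, ι t = ι s}`. -/
noncomputable def sminus (ιs : ℤ → I) (s : ℤ) : ℤ := sSup {t : ℤ | t < s ∧ ιs t = ιs s}

/-- An admissible sequence `(ιₖ, pₖ)_{k ∈ ℤ}` in `I × ℤ`, with respect to a finite simple
graph `Δ` on `I` and an automorphism `σ` of `Δ`. -/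
structure IsAdmissibleSeq (Δ : SimpleGraph I) (σ : Equiv.Perm I)
    (ιs : ℤ → I) (p : ℤ → ℤ) : Prop where
  /-- `σ` is an automorphism of `Δ`. -/
  adj_iff : ∀ i j : I, Δ.Adj (σ i) (σ j) ↔ Δ.Adj i j
  /-- each fiber of `ιs` is unbounded above -/
  unbdd_above : ∀ (i : I) (n : ℤ), ∃ k, n < k ∧ ιs k = i
  /-- each fiber of `ιs` is unbounded below -/
  unbdd_below : ∀ (i : I) (n : ℤ), ∃ k, k < n ∧ ιs k = i
  /-- (a) `p_{s⁺} = pₛ + 2 d_{ιₛ}` -/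
  ha : ∀ s : ℤ, p (splus ιs s) = p s + 2 * (orbSize σ (ιs s) : ℤ)
  /-- (b) `pₜ = pₛ + min(d_{ιₛ}, d_{ιₜ})` whenever `ιₛ ∼ ιₜ` and `t⁻ < s < t < s⁺` -/
  hb : ∀ s t : ℤ, Δ.Adj (ιs s) (ιs t) → sminus ιs t < s → s < t → t < splus ιs s →
        p t = p s + min (orbSize σ (ιs s) : ℤ) (orbSize σ (ιs t) : ℤ)
  /-- (c) `pₜ − (pₛ + 2) ∈ 2 d_{ιₛ} ℤ` whenever `ιₜ = σ(ιₛ)` -/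
  hc : ∀ s t : ℤ, ιs t = σ (ιs s) → (2 * (orbSize σ (ιs s) : ℤ)) ∣ (p t - (p s + 2))

theorem orbSize_pos (σ : Equiv.Perm I) (i : I) : 0 < orbSize σ i := by
  have : Nonempty {j : I | ∃ k : ℤ, (σ ^ k) i = j} := ⟨⟨i, 0, by simp⟩⟩
  exact Nat.card_pos

namespace IsAdmissibleSeq

variable {Δ : SimpleGraph I} {σ : Equiv.Perm I} {ιs : ℤ → I} {p : ℤ → ℤ}

omit [Fintype I] in
theorem isLeast_splus (h : IsAdmissibleSeq Δ σ ιs p) (s : ℤ) :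
    IsLeast {t : ℤ | s < t ∧ ιs t = ιs s} (splus ιs s) := by
  have hb : BddBelow {t : ℤ | s < t ∧ ιs t = ιs s} := ⟨s, fun _ hx => hx.1.le⟩
  exact ⟨Int.csInf_mem (h.unbdd_above (ιs s) s) hb, fun _ hx => csInf_le hb hx⟩

omit [Fintype I] in
theorem isGreatest_sminus (h : IsAdmissibleSeq Δ σ ιs p) (s : ℤ) :
    IsGreatest {t : ℤ | t < s ∧ ιs t = ιs s} (sminus ιs s) := by
  have hb : BddAbove {t : ℤ | t < s ∧ ιs t = ιs s} := ⟨s, fun _ hx => hx.1.le⟩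
  exact ⟨Int.csSup_mem (h.unbdd_below (ιs s) s) hb, fun _ hx => le_csSup hb hx⟩

omit [Fintype I] in
theorem exists_first_after (h : IsAdmissibleSeq Δ σ ιs p) (i : I) (n : ℤ) :
    ∃ k, n < k ∧ ιs k = i ∧ ∀ l, n < l → ιs l = i → k ≤ l := by
  obtain ⟨k, hk, hmin⟩ := Int.exists_least_of_bdd (P := fun k => n < k ∧ ιs k = i)
    ⟨n, fun _ hz => hz.1.le⟩ (h.unbdd_above i n)
  exact ⟨k, hk.1, hk.2, fun l hl hl' => hmin l ⟨hl, hl'⟩⟩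

omit [Fintype I] in
theorem exists_last_before (h : IsAdmissibleSeq Δ σ ιs p) (i : I) (n : ℤ) :
    ∃ k, k < n ∧ ιs k = i ∧ ∀ l, l < n → ιs l = i → l ≤ k := by
  obtain ⟨k, hk, hmax⟩ := Int.exists_greatest_of_bdd (P := fun k => k < n ∧ ιs k = i)
    ⟨n, fun _ hz => hz.1.le⟩ (h.unbdd_below i n)
  exact ⟨k, hk.1, hk.2, fun l hl hl' => hmax l ⟨hl, hl'⟩⟩

theorem lt_and_dvd_of_lt (h : IsAdmissibleSeq Δ σ ιs p) (n : ℕ) :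
    ∀ x y : ℤ, y - x ≤ n → x < y → ιs y = ιs x →
      p x < p y ∧ 2 * (orbSize σ (ιs x) : ℤ) ∣ p y - p x := by
  induction n with
  | zero => intro x y hn hxy; omega
  | succ n ih =>
    intro x y hn hxy hc
    obtain ⟨⟨hlt, hcol⟩, hmin⟩ := h.isLeast_splus x
    have hle : splus ιs x ≤ y := hmin ⟨hxy, hc⟩
    have ha := h.ha x
    have hd := orbSize_pos σ (ιs x)
    rcases hle.eq_or_lt with heq | hlt'
    · rw [heq] at ha
      exact ⟨by omega, ⟨1, by linarith⟩⟩
    · obtain ⟨h1, h2⟩ := ih (splus ιs x) y (by omega) hlt' (hc.trans hcol.symm)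
      rw [hcol] at h2
      obtain ⟨c, hc⟩ := h2
      exact ⟨by omega, c + 1, by linarith⟩

theorem lt_of_lt_of_eq (h : IsAdmissibleSeq Δ σ ιs p) {x y : ℤ} (hxy : x < y)
    (hc : ιs y = ιs x) : p x < p y :=
  (h.lt_and_dvd_of_lt (y - x).toNat x y (by omega) hxy hc).1

theorem le_of_le_of_eq (h : IsAdmissibleSeq Δ σ ιs p) {x y : ℤ} (hxy : x ≤ y)
    (hc : ιs y = ιs x) : p x ≤ p y := by
  rcases hxy.eq_or_lt with rfl | hlt
  · exact le_rfl
  · exact (h.lt_of_lt_of_eq hlt hc).le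

theorem dvd_sub_of_eq (h : IsAdmissibleSeq Δ σ ιs p) {x y : ℤ} (hc : ιs y = ιs x) :
    2 * (orbSize σ (ιs x) : ℤ) ∣ p y - p x := by
  rcases lt_trichotomy x y with hlt | rfl | hlt
  · exact (h.lt_and_dvd_of_lt (y - x).toNat x y (by omega) hlt hc).2
  · simp
  · rw [dvd_sub_comm, ← hc]
    exact (h.lt_and_dvd_of_lt (x - y).toNat y x (by omega) hlt hc.symm).2

omit [Fintype I] in
/-- Property (b) in terms of two neighbouring occurrences of adjacent vertices. -/
theorem eq_add_min (h : IsAdmissibleSeq Δ σ ιs p) {x y : ℤ} (hadj : Δ.Adj (ιs x) (ιs y))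
    (hxy : x < y) (hx : ∀ l, l < y → ιs l = ιs x → l ≤ x)
    (hy : ∀ l, x < l → ιs l = ιs y → y ≤ l) :
    p y = p x + min (orbSize σ (ιs x) : ℤ) (orbSize σ (ιs y) : ℤ) := by
  obtain ⟨⟨h1, h2⟩, -⟩ := h.isLeast_splus x
  obtain ⟨⟨h3, h4⟩, -⟩ := h.isGreatest_sminus y
  refine h.hb x y hadj ?_ hxy ?_
  · by_contra! hle
    rcases hle.eq_or_lt with heq | hlt
    · exact hadj.ne (by rw [heq]; exact h4)
    · exact absurd (hy _ hlt h4) (by omega)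
  · by_contra! hle
    rcases hle.eq_or_lt with heq | hlt
    · exact hadj.ne (by rw [← heq]; exact h2.symm)
    · exact absurd (hx _ hlt h2) (by omega)

theorem lt_of_lt_of_adj (h : IsAdmissibleSeq Δ σ ιs p) {s t : ℤ}
    (hadj : Δ.Adj (ιs s) (ιs t)) (hst : s < t) : p s < p t := by
  obtain ⟨x, hxt, hx, hxmax⟩ := h.exists_last_before (ιs s) t
  obtain ⟨y, hxy, hy, hymin⟩ := h.exists_first_after (ιs t) x
  have hyt : y ≤ t := hymin t hxt rfl
  have key := h.eq_add_min (x := x) (y := y) (by rwa [hx, hy]) hxy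
    (fun l hl hl' => hxmax l (by omega) (hl'.trans hx))
    (fun l hl hl' => hymin l hl (hl'.trans hy))
  have h1 := h.le_of_le_of_eq (hxmax s hst rfl) hx
  have h2 := h.le_of_le_of_eq hyt hy.symm
  have := orbSize_pos σ (ιs x)
  have := orbSize_pos σ (ιs y)
  omega

/-- Between two consecutive occurrences of a vertex `i`, an adjacent vertex with an orbit at least
as large occurs at most once; hence each of its occurrences is a neighbour of one of `i`. -/
theorem dvd_of_orbSize_le (h : IsAdmissibleSeq Δ σ ιs p) {s t : ℤ}
    (hadj : Δ.Adj (ιs s) (ιs t)) (hle : orbSize σ (ιs s) ≤ orbSize σ (ιs t)) :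
    2 * (orbSize σ (ιs s) : ℤ) ∣ p s - p t - orbSize σ (ιs s) := by
  obtain ⟨x, hxt, hx, hxmax⟩ := h.exists_last_before (ιs s) t
  obtain ⟨y, hxy, hy, hymin⟩ := h.exists_first_after (ιs t) x
  obtain ⟨u, htu, hu, humin⟩ := h.exists_first_after (ιs s) t
  obtain ⟨z, hzu, hz, hzmax⟩ := h.exists_last_before (ιs t) u
  have hyt : y ≤ t := hymin t hxt rfl
  have htz : t ≤ z := hzmax t htu rfl
  have gap : ∀ l, x < l → ιs l = ιs s → u ≤ l := by
    intro l hl hl'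
    rcases lt_trichotomy l t with hlt | rfl | hlt
    · exact absurd (hxmax l hlt hl') (by omega)
    · exact absurd hl'.symm hadj.ne
    · exact humin l hlt hl'
  have hxy' := h.eq_add_min (x := x) (y := y) (by rwa [hx, hy]) hxy
    (fun l hl hl' => hxmax l (by omega) (hl'.trans hx))
    (fun l hl hl' => hymin l hl (hl'.trans hy))
  have hzu' := h.eq_add_min (x := z) (y := u) (by rw [hz, hu]; exact hadj.symm) hzu
    (fun l hl hl' => hzmax l hl (hl'.trans hz))
    (fun l hl hl' => gap l (by omega) (hl'.trans hu))
  have hsucc : splus ιs x = u := (h.isLeast_splus x).unique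
    ⟨⟨by omega, hu.trans hx.symm⟩, fun l hl => gap l hl.1 (hl.2.trans hx)⟩
  have ha := h.ha x
  rw [hsucc, hx] at ha
  rw [hx, hy] at hxy'
  rw [hz, hu] at hzu'
  have hyz : p y = p z := by omega
  have h1 := h.le_of_le_of_eq hyt hy.symm
  have h2 := h.le_of_le_of_eq htz hz
  have hpt : p t = p x + orbSize σ (ιs s) := by omega
  obtain ⟨c, hc⟩ := h.dvd_sub_of_eq (x := s) (y := x) hx
  exact ⟨-c - 1, by linarith⟩

end IsAdmissibleSeq

theorem stmt14 (Δ : SimpleGraph I) (σ : Equiv.Perm I) (ιs : ℤ → I) (p : ℤ → ℤ)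
    (h : IsAdmissibleSeq Δ σ ιs p) (s t : ℤ) (hadj : Δ.Adj (ιs s) (ιs t)) :
    (p s < p t ↔ s < t) ∧
    (2 * min (orbSize σ (ιs s) : ℤ) (orbSize σ (ιs t) : ℤ)) ∣
      (p s - p t - min (orbSize σ (ιs s) : ℤ) (orbSize σ (ιs t) : ℤ)) := by
  refine ⟨⟨fun hp => ?_, h.lt_of_lt_of_adj hadj⟩, ?_⟩
  · rcases lt_trichotomy s t with hlt | rfl | hlt
    · exact hlt
    · exact absurd rfl hadj.ne
    · exact absurd (h.lt_of_lt_of_adj hadj.symm hlt) hp.not_gt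
  · rcases le_total (orbSize σ (ιs s)) (orbSize σ (ιs t)) with hle | hle
    · rw [min_eq_left (by exact_mod_cast hle)]
      exact h.dvd_of_orbSize_le hadj hle
    · rw [min_eq_right (by exact_mod_cast hle)]
      obtain ⟨c, hc⟩ := h.dvd_of_orbSize_le hadj.symm hle
      exact ⟨-c - 1, by linarith⟩
end

section
/- Let (ιₖ, pₖ)_{k∈ℤ} be an admissible sequence. Then: (1) the map k ↦ (ιₖ, pₖ) from ℤ to I × ℤ is injective; (2) for s, t ∈ ℤ, one has ιₛ = ιₜ together with pₛ = pₜ + 2d_{ιₛ} if and only if t = s⁻; (3) for s, t ∈ ℤ with ιₛ ∼ ιₜ, one has pₛ = pₜ − 2d_{ιₜ} + min(d_{ιₛ}, d_{ιₜ}) if and only if s⁻ < t⁻ < s < t. Consequently, k ↦ (ιₖ, pₖ) is an isomorphism from the quiver Γ_GLS (vertex set ℤ; arrows s → s⁻ for every s, and s → t whenever s⁻ < t⁻ < s < t and ιₛ ∼ ιₜ) onto the full subquiver of the quiver Γ_HL (vertex set I × ℤ; arrows (i,x) → (j,y) whenever i ∼ j and x = y − 2dⱼ + min(dᵢ,dⱼ),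 or i = j and x = y + 2dᵢ) supported on its image. -/
open Set

variable {I : Type*} [Fintype I]

section FiberNeighbours

variable {J : Type*} {ιs : ℤ → J}

theorem exists_first_occurrence_after (hub : ∀ (i : J) (n : ℤ), ∃ k, n < k ∧ ιs k = i)
    (i : J) (n : ℤ) : ∃ k, n < k ∧ ιs k = i ∧ ∀ t, n < t → ιs t = i → k ≤ t := by
  obtain ⟨k, ⟨hk, hi⟩, hmin⟩ := Int.exists_least_of_bdd (P := fun k => n < k ∧ ιs k = i)
    ⟨n, fun z hz => hz.1.le⟩ (hub i n)
  exact ⟨k, hk, hi, fun t ht hti => hmin t ⟨ht, hti⟩⟩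

theorem exists_last_occurrence_before (hlb : ∀ (i : J) (n : ℤ), ∃ k, k < n ∧ ιs k = i)
    (i : J) (n : ℤ) : ∃ k, k < n ∧ ιs k = i ∧ ∀ t, t < n → ιs t = i → t ≤ k := by
  obtain ⟨k, ⟨hk, hi⟩, hmax⟩ := Int.exists_greatest_of_bdd (P := fun k => k < n ∧ ιs k = i)
    ⟨n, fun z hz => hz.1.le⟩ (hlb i n)
  exact ⟨k, hk, hi, fun t ht hti => hmax t ⟨ht, hti⟩⟩

theorem splus_eq_of_isLeast {s t : ℤ} (hst : s < t) (hι : ιs t = ιs s)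
    (hmin : ∀ r, s < r → ιs r = ιs s → t ≤ r) : splus ιs s = t :=
  IsLeast.csInf_eq ⟨⟨hst, hι⟩, fun r hr => hmin r hr.1 hr.2⟩

theorem sminus_eq_of_isGreatest {s t : ℤ} (hts : t < s) (hι : ιs t = ιs s)
    (hmax : ∀ r, r < s → ιs r = ιs s → r ≤ t) : sminus ιs s = t :=
  IsGreatest.csSup_eq ⟨⟨hts, hι⟩, fun r hr => hmax r hr.1 hr.2⟩

theorem splus_spec (hub : ∀ (i : J) (n : ℤ), ∃ k, n < k ∧ ιs k = i) (s : ℤ) :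
    s < splus ιs s ∧ ιs (splus ιs s) = ιs s ∧
      ∀ r, s < r → ιs r = ιs s → splus ιs s ≤ r := by
  obtain ⟨k, hk, hi, hmin⟩ := exists_first_occurrence_after hub (ιs s) s
  rw [splus_eq_of_isLeast hk hi hmin]
  exact ⟨hk, hi, hmin⟩

theorem sminus_spec (hlb : ∀ (i : J) (n : ℤ), ∃ k, k < n ∧ ιs k = i) (s : ℤ) :
    sminus ιs s < s ∧ ιs (sminus ιs s) = ιs s ∧
      ∀ r, r < s → ιs r = ιs s → r ≤ sminus ιs s := by
  obtain ⟨k, hk, hi, hmax⟩ := exists_last_occurrence_before hlb (ιs s) s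
  rw [sminus_eq_of_isGreatest hk hi hmax]
  exact ⟨hk, hi, hmax⟩

theorem splus_sminus (hlb : ∀ (i : J) (n : ℤ), ∃ k, k < n ∧ ιs k = i) (s : ℤ) :
    splus ιs (sminus ιs s) = s := by
  obtain ⟨hlt, hι, hmax⟩ := sminus_spec hlb s
  refine splus_eq_of_isLeast hlt hι.symm fun r hr hrι => ?_
  by_contra! hrs
  exact absurd (hmax r hrs (hrι.trans hι)) (not_le.mpr hr)

theorem sminus_splus (hub : ∀ (i : J) (n : ℤ), ∃ k, n < k ∧ ιs k = i) (s : ℤ) :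
    sminus ιs (splus ιs s) = s := by
  obtain ⟨hlt, hι, hmin⟩ := splus_spec hub s
  refine sminus_eq_of_isGreatest hlt hι.symm fun r hr hrι => ?_
  by_contra! hrs
  exact absurd (hmin r hrs (hrι.trans hι)) (not_le.mpr hr)

end FiberNeighbours

namespace IsAdmissibleSeq

variable {J : Type*} {Δ : SimpleGraph J} {σ : Equiv.Perm J} {ιs : ℤ → J} {p : ℤ → ℤ}

theorem p_eq_p_sminus_add (h : IsAdmissibleSeq Δ σ ιs p) (s : ℤ) :
    p s = p (sminus ιs s) + 2 * (orbSize σ (ιs s) : ℤ) := by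
  have := h.ha (sminus ιs s)
  rwa [splus_sminus h.unbdd_below, (sminus_spec h.unbdd_below s).2.1] at this

theorem p_add_le_of_lt (h : IsAdmissibleSeq Δ σ ιs p) {s t : ℤ} (hι : ιs s = ιs t)
    (hst : s < t) : p s + 2 * (orbSize σ (ιs s) : ℤ) ≤ p t := by
  obtain ⟨n, hn⟩ : ∃ n : ℕ, (t - s).toNat = n := ⟨_, rfl⟩
  induction n using Nat.strong_induction_on generalizing t with
  | _ n ih =>
    obtain ⟨hlt, hι', hmax⟩ := sminus_spec h.unbdd_below t
    have hp := h.p_eq_p_sminus_add t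
    rw [← hι] at hp
    rcases (hmax s hst hι).eq_or_lt with heq | hs
    · rw [← heq] at hp
      exact hp.ge
    · have := ih _ (by omega) (hι.trans hι'.symm) hs rfl
      omega

theorem p_le_of_le (h : IsAdmissibleSeq Δ σ ιs p) {s t : ℤ} (hι : ιs s = ιs t)
    (hst : s ≤ t) : p s ≤ p t := by
  rcases hst.eq_or_lt with rfl | hlt
  · rfl
  · have := h.p_add_le_of_lt hι hlt
    omega

variable [Fintype J]

theorem eq_of_p_eq (h : IsAdmissibleSeq Δ σ ιs p) {s t : ℤ} (hι : ιs s = ιs t)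
    (hp : p s = p t) : s = t := by
  have hs := orbSize_pos σ (ιs s)
  have ht := orbSize_pos σ (ιs t)
  rcases lt_trichotomy s t with hlt | heq | hgt
  · have := h.p_add_le_of_lt hι hlt
    omega
  · exact heq
  · have := h.p_add_le_of_lt hι.symm hgt
    omega

theorem eq_sminus_iff (h : IsAdmissibleSeq Δ σ ιs p) (s t : ℤ) :
    (ιs s = ιs t ∧ p s = p t + 2 * (orbSize σ (ιs s) : ℤ)) ↔ t = sminus ιs s := by
  constructor
  · rintro ⟨hι, hp⟩
    have hs : s = splus ιs t := by
      refine h.eq_of_p_eq (hι.trans (splus_spec h.unbdd_above t).2.1.symm) ?_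
      rw [h.ha t, hp, hι]
    rw [hs, sminus_splus h.unbdd_above]
  · rintro rfl
    exact ⟨(sminus_spec h.unbdd_below s).2.1.symm, h.p_eq_p_sminus_add s⟩

/-- For adjacent labels, `p s = p u + min (d s) (d u)` forces `s` to be the first occurrence of
its label after `u`, and to precede `u⁺`. -/
theorem interlace_of_p_eq (h : IsAdmissibleSeq Δ σ ιs p) {s u : ℤ}
    (hadj : Δ.Adj (ιs s) (ιs u))
    (hp : p s = p u + min (orbSize σ (ιs s) : ℤ) (orbSize σ (ιs u) : ℤ)) :
    sminus ιs s < u ∧ u < s ∧ s < splus ιs u := by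
  obtain ⟨r, hur, hrs, hrmin⟩ := exists_first_occurrence_after h.unbdd_above (ιs s) u
  obtain ⟨hqr, hqι, -⟩ := sminus_spec h.unbdd_below r
  obtain ⟨huv, hvι, -⟩ := splus_spec h.unbdd_above u
  have hqs : ιs (sminus ιs r) = ιs s := hqι.trans hrs
  have hne : ∀ {x y : ℤ}, ιs x = ιs s → ιs y = ιs u → x ≠ y := by
    rintro x y hx hy rfl
    exact hadj.ne (hx.symm.trans hy)
  have hqu : sminus ιs r < u := by
    refine lt_of_le_of_ne ?_ (hne hqs rfl)
    by_contra! hlt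
    exact absurd (hrmin _ hlt hqs) (not_le.mpr hqr)
  have hm : 0 < min (orbSize σ (ιs s) : ℤ) (orbSize σ (ιs u) : ℤ) :=
    lt_min (mod_cast orbSize_pos σ _) (mod_cast orbSize_pos σ _)
  rcases lt_or_gt_of_ne (hne hrs hvι) with hrv | hvr
  · have hpr := h.hb u r (by rw [hrs]; exact hadj.symm) hqu hur hrv
    rw [hrs, min_comm] at hpr
    obtain rfl : s = r := h.eq_of_p_eq hrs.symm (hp.trans hpr.symm)
    exact ⟨hqu, hur, hrv⟩
  · exfalso
    obtain ⟨w, hwr, hwι, hwmax⟩ := exists_last_occurrence_before h.unbdd_below (ιs u) r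
    have hvw := hwmax _ hvr hvι
    have hpw : p u ≤ p w := h.p_le_of_le hwι.symm (huv.le.trans hvw)
    have hpuw := h.p_add_le_of_lt hwι.symm (huv.trans_le hvw)
    have hpr := h.hb w r (by rw [hrs, hwι]; exact hadj.symm) (hqu.trans (huv.trans_le hvw)) hwr (by
      obtain ⟨hlt, hι, -⟩ := splus_spec h.unbdd_above w
      by_contra! hle
      rcases hle.eq_or_lt with heq | hlt'
      · exact hne hrs (hι.trans hwι) heq.symm
      · exact absurd (hwmax _ hlt' (hι.trans hwι)) (not_le.mpr hlt))
    rw [hrs, hwι, min_comm] at hpr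
    have hd := orbSize_pos σ (ιs u)
    have hsr : s < r := by
      by_contra! hle
      have := h.p_le_of_le hrs hle
      omega
    have hpsq := h.p_le_of_le hqs.symm ((sminus_spec h.unbdd_below r).2.2 s hsr hrs.symm)
    obtain ⟨v, hqv, hvι', hvmin⟩ :=
      exists_first_occurrence_after h.unbdd_above (ιs u) (sminus ιs r)
    have hvu := hvmin u hqu rfl
    have hpv := h.hb (sminus ιs r) v (by rw [hqs, hvι']; exact hadj) (by
      obtain ⟨hlt, hι, -⟩ := sminus_spec h.unbdd_below v
      by_contra! hle
      rcases hle.eq_or_lt with heq | hlt'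
      · exact hne hqs (hι.trans hvι') heq
      · exact absurd (hvmin _ hlt' (hι.trans hvι')) (not_le.mpr hlt)) hqv
      (by rw [splus_sminus h.unbdd_below]; exact hvu.trans_lt hur)
    rw [hqs, hvι'] at hpv
    have hpvu := h.p_le_of_le hvι' hvu
    omega

theorem p_eq_iff_interlace (h : IsAdmissibleSeq Δ σ ιs p) {s t : ℤ}
    (hadj : Δ.Adj (ιs s) (ιs t)) :
    p s = p t - 2 * (orbSize σ (ιs t) : ℤ)
          + min (orbSize σ (ιs s) : ℤ) (orbSize σ (ιs t) : ℤ) ↔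
      (sminus ιs s < sminus ιs t ∧ sminus ιs t < s ∧ s < t) := by
  have hι := (sminus_spec h.unbdd_below t).2.1
  have hpt := h.p_eq_p_sminus_add t
  have hadj' : Δ.Adj (ιs s) (ιs (sminus ιs t)) := by rwa [hι]
  constructor
  · intro hp
    have := h.interlace_of_p_eq hadj' (by rw [hι]; omega)
    rwa [splus_sminus h.unbdd_below] at this
  · rintro ⟨h₁, h₂, h₃⟩
    have := h.hb _ _ hadj'.symm h₁ h₂ (by rwa [splus_sminus h.unbdd_below])
    rw [hι, min_comm] at this
    omega

end IsAdmissibleSeq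

theorem stmt15 (Δ : SimpleGraph I) (σ : Equiv.Perm I) (ιs : ℤ → I) (p : ℤ → ℤ)
    (h : IsAdmissibleSeq Δ σ ιs p) :
    (Function.Injective (fun k : ℤ => (ιs k, p k))) ∧
    (∀ s t : ℤ,
      (ιs s = ιs t ∧ p s = p t + 2 * (orbSize σ (ιs s) : ℤ)) ↔ t = sminus ιs s) ∧
    (∀ s t : ℤ, Δ.Adj (ιs s) (ιs t) →
      (p s = p t - 2 * (orbSize σ (ιs t) : ℤ)
          + min (orbSize σ (ιs s) : ℤ) (orbSize σ (ιs t) : ℤ) ↔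
        (sminus ιs s < sminus ιs t ∧ sminus ιs t < s ∧ s < t))) ∧
    (∀ s t : ℤ,
      ((sminus ιs s < sminus ιs t ∧ sminus ιs t < s ∧ s < t ∧ Δ.Adj (ιs s) (ιs t)) ∨
        t = sminus ιs s)
      ↔
      ((Δ.Adj (ιs s) (ιs t) ∧
          p s = p t - 2 * (orbSize σ (ιs t) : ℤ)
            + min (orbSize σ (ιs s) : ℤ) (orbSize σ (ιs t) : ℤ)) ∨
        (ιs s = ιs t ∧ p s = p t + 2 * (orbSize σ (ιs s) : ℤ)))) := by
  refine ⟨fun s t hst => ?_, h.eq_sminus_iff, fun s t => h.p_eq_iff_interlace, fun s t => ?_⟩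
  · obtain ⟨hι, hp⟩ := Prod.mk.inj hst
    exact h.eq_of_p_eq hι hp
  · rw [h.eq_sminus_iff, and_congr_right fun hadj => h.p_eq_iff_interlace hadj]
    tauto
end
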